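/- arXiv:2110.06709 — 2 statements merged into one kernel-verified Lean document; each statement's English description precedes it below -/
import Mathlib

section
/- Let G be a small finite subgroup of GL(2,ℂ), let χ : G → G be a group homomorphism, and let Φ : ℂ² → ℂ² be an étale polynomial endomorphism such that Φ⁻¹({0}) = {0} and Φ(g·v) = χ(g)·Φ(v) for all g ∈ G and all v ∈ ℂ². Then χ is injective, hence a group automorphism of G. -/
open MvPolynomial Matrix

theorem hasDerivAt_line (p : MvPolynomial (Fin 2) ℂ) (v : Fin 2 → ℂ) (t : ℂ) :
    HasDerivAt (fun t : ℂ => eval (t • v) p)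
      (v 0 * eval (t • v) (pderiv 0 p) + v 1 * eval (t • v) (pderiv 1 p)) t := by
  induction p using MvPolynomial.induction_on with
  | C a => simpa using hasDerivAt_const t a
  | add p q hp hq =>
    have h := hp.add hq
    simp only [map_add]
    exact h.congr_deriv (by ring)
  | mul_X p i hp =>
    have hx : HasDerivAt (fun t : ℂ => t * v i) (v i) t := by
      simpa using (hasDerivAt_id t).mul_const (v i)
    have h := hp.mul hx
    simp only [map_mul, eval_X, Pi.smul_apply, smul_eq_mul]
    refine h.congr_deriv ?_
    fin_cases i <;> simp [pderiv_X] <;> ring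

/-- If `G` is a small finite subgroup of `GL(2,ℂ)`, `χ : G → G` a group
homomorphism, and `Φ : ℂ² → ℂ²` an étale polynomial endomorphism with
`Φ⁻¹({0}) = {0}` and `Φ (g • v) = χ(g) • Φ v`, then `χ` is injective,
hence an automorphism of the finite group `G`. -/
theorem twisting_homomorphism_is_injective
    (G : Subgroup (Matrix.GeneralLinearGroup (Fin 2) ℂ))
    (hfin : Finite G)
    (hsmall : ∀ g ∈ G, g ≠ 1 → ∀ v : Fin 2 → ℂ, v ≠ 0 →
      (g : Matrix (Fin 2) (Fin 2) ℂ).mulVec v ≠ v)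
    (χ : G →* G)
    (F : Fin 2 → MvPolynomial (Fin 2) ℂ)
    (hetale : ∃ c : ℂ, c ≠ 0 ∧
      pderiv 0 (F 0) * pderiv 1 (F 1) - pderiv 1 (F 0) * pderiv 0 (F 1) = C c)
    (hfiber : (fun v : Fin 2 → ℂ => fun i => eval v (F i)) ⁻¹' {0} = {0})
    (hequiv : ∀ g : G, ∀ v : Fin 2 → ℂ,
      (fun i => eval (((g : Matrix.GeneralLinearGroup (Fin 2) ℂ) :
          Matrix (Fin 2) (Fin 2) ℂ).mulVec v) (F i)) =
        ((χ g : Matrix.GeneralLinearGroup (Fin 2) ℂ) :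
          Matrix (Fin 2) (Fin 2) ℂ).mulVec (fun i => eval v (F i))) :
    Function.Injective χ := by
  rw [injective_iff_map_eq_one]
  intro g hg
  obtain ⟨c, hc, hdet⟩ := hetale
  have key : ∀ v : Fin 2 → ℂ, ((g : Matrix.GeneralLinearGroup (Fin 2) ℂ) :
      Matrix (Fin 2) (Fin 2) ℂ).mulVec v = v := by
    intro v
    set w := ((g : Matrix.GeneralLinearGroup (Fin 2) ℂ) :
      Matrix (Fin 2) (Fin 2) ℂ).mulVec v with hw
    have hE : ∀ i, w 0 * eval 0 (pderiv 0 (F i)) + w 1 * eval 0 (pderiv 1 (F i)) =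
        v 0 * eval 0 (pderiv 0 (F i)) + v 1 * eval 0 (pderiv 1 (F i)) := by
      intro i
      have h1 := hasDerivAt_line (F i) w 0
      have h2 := hasDerivAt_line (F i) v 0
      have hfun : (fun t : ℂ => eval (t • w) (F i)) = fun t : ℂ => eval (t • v) (F i) := by
        funext t
        have h := congrFun (hequiv g (t • v)) i
        rw [hg, Matrix.mulVec_smul, ← hw] at h
        simpa using h
      rw [hfun] at h1
      simpa only [zero_smul] using h1.unique h2
    have hd := congrArg (eval (0 : Fin 2 → ℂ)) hdet
    simp only [map_sub, map_mul, eval_C] at hd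
    have e0 := hE 0
    have e1 := hE 1
    funext j
    apply mul_left_cancel₀ hc
    rw [← hd]
    fin_cases j
    · simp only [Fin.zero_eta]
      linear_combination eval 0 (pderiv 1 (F 1)) * e0 - eval 0 (pderiv 1 (F 0)) * e1
    · simp only [Fin.mk_one]
      linear_combination eval 0 (pderiv 0 (F 0)) * e1 - eval 0 (pderiv 0 (F 1)) * e0
  apply Subtype.ext
  apply Units.ext
  apply Matrix.ext_of_mulVec_single
  intro i
  rw [key]
  exact (Matrix.one_mulVec _).symm
end

section
/- Let f, g ∈ ℂ[X,Y] be polynomials whose Jacobian determinant (∂f/∂X)(∂g/∂Y) − (∂f/∂Y)(∂g/∂X) is a nonzero constant, and let ψ be the ℂ-algebra endomorphism of ℂ[X,Y] determined by X ↦ f, Y ↦ g. Suppose the corresponding polynomial endomorphism of ℂ² is birational, i.e., the induced ℂ-algebra endomorphism of the fraction field ℂ(X,Y) is surjective. Then ψ is bijective; that is, the corresponding polynomial endomorphism of ℂ² is a polynomial automorphism. -/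
open MvPolynomial

namespace KellerBir

theorem chain_rule (f g P : MvPolynomial (Fin 2) ℂ) (i : Fin 2) :
    pderiv i (aeval ![f, g] P) =
      aeval ![f, g] (pderiv 0 P) * pderiv i f + aeval ![f, g] (pderiv 1 P) * pderiv i g := by
  induction P using MvPolynomial.induction_on with
  | C a => simp
  | add p q hp hq => simp only [map_add, hp, hq]; ring
  | mul_X p j hp =>
    simp only [map_mul, pderiv_mul, hp, map_add, aeval_X]
    fin_cases j <;> simp [pderiv_X] <;> ring

theorem inj_aux (f g : MvPolynomial (Fin 2) ℂ) (c : ℂ) (hc : c ≠ 0)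
    (hjac : pderiv 0 f * pderiv 1 g - pderiv 1 f * pderiv 0 g = C c) (n : ℕ) :
    ∀ P : MvPolynomial (Fin 2) ℂ, (∀ m, coeff m P ≠ 0 → m 0 + m 1 < n) →
      aeval ![f, g] P = 0 → P = 0 := by
  induction n with
  | zero =>
    intro P h _
    ext m
    by_contra hm
    exact absurd (h m (by simpa using hm)) (by simp)
  | succ n ih =>
    intro P h hP
    have hC : (C c : MvPolynomial (Fin 2) ℂ) ≠ 0 := by simpa using hc
    have e0 := chain_rule f g P 0
    have e1 := chain_rule f g P 1
    rw [hP, map_zero] at e0 e1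
    have z0 : aeval ![f, g] (pderiv 0 P) = 0 := by
      have : C c * aeval ![f, g] (pderiv 0 P) = 0 := by
        rw [← hjac]; linear_combination (-pderiv 1 g) * e0 + pderiv 0 g * e1
      exact (mul_eq_zero.mp this).resolve_left hC
    have z1 : aeval ![f, g] (pderiv 1 P) = 0 := by
      have : C c * aeval ![f, g] (pderiv 1 P) = 0 := by
        rw [← hjac]; linear_combination (pderiv 1 f) * e0 - pderiv 0 f * e1
      exact (mul_eq_zero.mp this).resolve_left hC
    have d0 : pderiv 0 P = 0 := by
      refine ih _ (fun m hm => ?_) z0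
      rw [coeff_pderiv] at hm
      have := h _ (left_ne_zero_of_mul hm)
      simp at this
      omega
    have d1 : pderiv 1 P = 0 := by
      refine ih _ (fun m hm => ?_) z1
      rw [coeff_pderiv] at hm
      have := h _ (left_ne_zero_of_mul hm)
      simp at this
      omega
    have key : ∀ i : Fin 2, pderiv i P = 0 → ∀ m : Fin 2 →₀ ℕ, m i ≠ 0 → coeff m P = 0 := by
      intro i hi m hm
      have h1 := coeff_pderiv (i := i) P (m - Finsupp.single i 1)
      have h2 : m - Finsupp.single i 1 + Finsupp.single i 1 = m := by
        apply tsub_add_cancel_of_le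
        simpa using Nat.one_le_iff_ne_zero.mpr hm
      rw [hi, h2, coeff_zero] at h1
      refine (mul_eq_zero.mp h1.symm).resolve_right ?_
      exact Nat.cast_add_one_ne_zero _
    have hPC : P = C (coeff 0 P) := by
      ext m
      rw [coeff_C]
      split_ifs with hm
      · rw [← hm]
      · by_cases h0 : m 0 = 0
        · by_cases h1 : m 1 = 0
          · exact absurd (by ext j; fin_cases j <;> simp [h0, h1]) hm
          · exact key 1 d1 m h1
        · exact key 0 d0 m h0
    rw [hPC] at hP ⊢
    simpa using hP

theorem inj (f g : MvPolynomial (Fin 2) ℂ) (c : ℂ) (hc : c ≠ 0)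
    (hjac : pderiv 0 f * pderiv 1 g - pderiv 1 f * pderiv 0 g = C c) :
    Function.Injective
      (aeval ![f, g] : MvPolynomial (Fin 2) ℂ →ₐ[ℂ] MvPolynomial (Fin 2) ℂ) := by
  rw [injective_iff_map_eq_zero]
  intro P hP
  refine inj_aux f g c hc hjac (P.support.sup (fun m => m 0 + m 1) + 1) P (fun m hm => ?_) hP
  exact Nat.lt_succ_of_le
    (Finset.le_sup (f := fun m : Fin 2 →₀ ℕ => m 0 + m 1) (mem_support_iff.mpr hm))

theorem maximal_of (I : Ideal (MvPolynomial (Fin 2) ℂ)) (hI : I.IsPrime)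
    (q p : MvPolynomial (Fin 2) ℂ) (hq : Prime q) (hqI : q ∈ I) (hpI : p ∈ I) (hqp : ¬ q ∣ p) :
    I.IsMaximal := by
  obtain ⟨M, hM, hIM⟩ := I.exists_le_maximal hI.ne_top
  by_contra hmax
  have hlt : I < M := lt_of_le_of_ne hIM (by rintro rfl; exact hmax hM)
  have hqprime : (Ideal.span {q}).IsPrime := (Ideal.span_singleton_prime hq.ne_zero).mpr hq
  let x0 : PrimeSpectrum (MvPolynomial (Fin 2) ℂ) := ⟨⊥, Ideal.isPrime_bot⟩
  let x1 : PrimeSpectrum (MvPolynomial (Fin 2) ℂ) := ⟨Ideal.span {q}, hqprime⟩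
  let x2 : PrimeSpectrum (MvPolynomial (Fin 2) ℂ) := ⟨I, hI⟩
  let x3 : PrimeSpectrum (MvPolynomial (Fin 2) ℂ) := ⟨M, hM.isPrime⟩
  have h01 : x0 < x1 := by
    change (⊥ : Ideal _) < Ideal.span {q}
    rw [bot_lt_iff_ne_bot]
    simpa using hq.ne_zero
  have h12 : x1 < x2 := by
    change Ideal.span {q} < I
    refine lt_of_le_of_ne ((Ideal.span_singleton_le_iff_mem _).mpr hqI) ?_
    rintro rfl
    exact hqp (Ideal.mem_span_singleton.mp hpI)
  have h23 : x2 < x3 := hlt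
  let s : LTSeries (PrimeSpectrum (MvPolynomial (Fin 2) ℂ)) :=
    { length := 3
      toFun := ![x0, x1, x2, x3]
      step := by
        intro i
        fin_cases i
        · exact h01
        · exact h12
        · exact h23 }
  have hs := Order.LTSeries.length_le_krullDim s
  have hd : Order.krullDim (PrimeSpectrum (MvPolynomial (Fin 2) ℂ)) = 2 := by
    have := MvPolynomial.ringKrullDim_of_isNoetherianRing (R := ℂ) (ι := Fin 2)
    rw [ringKrullDim_eq_zero_of_field] at this
    simpa [ringKrullDim] using this
  rw [hd] at hs
  have : s.length = 3 := rfl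
  rw [this] at hs
  exact absurd hs (by decide)

theorem no_contract (f g π : MvPolynomial (Fin 2) ℂ) (c : ℂ) (hc : c ≠ 0)
    (hjac : pderiv 0 f * pderiv 1 g - pderiv 1 f * pderiv 0 g = C c) (hπ : Prime π)
    (a b : ℂ) (hf : π ∣ f - C a) (hg : π ∣ g - C b) : False := by
  obtain ⟨u, hu⟩ := hf
  obtain ⟨v, hv⟩ := hg
  have hf : f = π * u + C a := by rw [← hu]; ring
  have hg : g = π * v + C b := by rw [← hv]; ring
  have hd : π ∣ C c := by
    rw [← hjac, hf, hg]
    simp only [map_add, pderiv_mul, pderiv_C]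
    refine ⟨pderiv 0 π * u * pderiv 1 v + pderiv 0 u * pderiv 1 π * v
      + π * pderiv 0 u * pderiv 1 v - pderiv 1 π * u * pderiv 0 v
      - pderiv 1 u * pderiv 0 π * v - π * pderiv 1 u * pderiv 0 v, by ring⟩
  exact hπ.not_isUnit (isUnit_of_dvd_unit hd ((isUnit_iff_ne_zero.mpr hc).map C))

end KellerBir



/-- An étale birational polynomial endomorphism of `ℂ²` is an automorphism: if
`f, g ∈ ℂ[X,Y]` have nonzero constant Jacobian and the induced `ℂ`-algebra
endomorphism of the fraction field `ℂ(X,Y)` is surjective (every element of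
`ℂ(X,Y)` is of the form `P(f,g)/Q(f,g)`), then the `ℂ`-algebra endomorphism
`ψ` of `ℂ[X,Y]` with `X ↦ f`, `Y ↦ g` is bijective. -/
theorem birational_etale_endomorphism_is_automorphism
    (f g : MvPolynomial (Fin 2) ℂ)
    (hjac : ∃ c : ℂ, c ≠ 0 ∧
      pderiv 0 f * pderiv 1 g - pderiv 1 f * pderiv 0 g = C c)
    (hbir : ∀ z : FractionRing (MvPolynomial (Fin 2) ℂ),
      ∃ p q : MvPolynomial (Fin 2) ℂ,
        (aeval ![f, g]) q ≠ 0 ∧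
        z * algebraMap (MvPolynomial (Fin 2) ℂ) (FractionRing (MvPolynomial (Fin 2) ℂ))
            ((aeval ![f, g]) q) =
          algebraMap (MvPolynomial (Fin 2) ℂ) (FractionRing (MvPolynomial (Fin 2) ℂ))
            ((aeval ![f, g]) p)) :
    Function.Bijective
      (aeval ![f, g] : MvPolynomial (Fin 2) ℂ →ₐ[ℂ] MvPolynomial (Fin 2) ℂ) := by
  obtain ⟨c, hc, hjac⟩ := hjac
  have hinj := KellerBir.inj f g c hc hjac
  refine ⟨hinj, fun b => ?_⟩
  obtain ⟨p, q, hq, hpq⟩ := hbir (algebraMap _ _ b)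
  rw [← map_mul] at hpq
  replace hpq := IsFractionRing.injective _ _ hpq
  have hq0 : q ≠ 0 := by rintro rfl; simp at hq
  obtain ⟨q', p', d, hrel, rfl, rfl⟩ :=
    UniqueFactorizationMonoid.exists_reduced_factors q hq0 p
  rw [map_mul] at hq hpq
  rw [map_mul] at hpq
  have hd := left_ne_zero_of_mul hq
  have hq' : aeval ![f, g] q' ≠ 0 := right_ne_zero_of_mul hq
  have hb : b * aeval ![f, g] q' = aeval ![f, g] p' := by
    apply mul_left_cancel₀ hd
    linear_combination hpq
  by_cases hu : IsUnit q'
  · obtain ⟨u, hu⟩ := hu.exists_right_inv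
    refine ⟨p' * u, ?_⟩
    rw [map_mul, ← hb, mul_assoc, ← map_mul, hu, map_one, mul_one]
  · exfalso
    obtain ⟨r, hr, hrq⟩ := WfDvdMonoid.exists_irreducible_factor hu (by rintro rfl; simp at hq')
    have hrp : ¬ r ∣ p' := fun h => hr.not_isUnit (hrel hrq h)
    have hr' : ¬ IsUnit (aeval ![f, g] r) := by
      intro h
      rw [isUnit_iff_eq_C_of_isReduced] at h
      obtain ⟨a, ha, hra⟩ := h
      have : r = C a := hinj (by rw [hra]; simp)
      exact hr.not_isUnit (this ▸ ha.map C)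
    have hr0 : aeval ![f, g] r ≠ 0 := fun h => hr.ne_zero (hinj (by rw [h, map_zero]))
    obtain ⟨π, hπ, hπr⟩ := WfDvdMonoid.exists_irreducible_factor hr' hr0
    have hπp : Prime π := hπ.prime
    have hπI : (Ideal.span {π}).IsPrime := (Ideal.span_singleton_prime hπp.ne_zero).mpr hπp
    have hmem : ∀ x, x ∈ (Ideal.span {π}).comap
        (aeval ![f, g] : MvPolynomial (Fin 2) ℂ →ₐ[ℂ] MvPolynomial (Fin 2) ℂ) ↔
        π ∣ aeval ![f, g] x := fun x => by
      rw [Ideal.mem_comap, Ideal.mem_span_singleton]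
    have hmax := KellerBir.maximal_of _ (hπI.comap
        (aeval ![f, g] : MvPolynomial (Fin 2) ℂ →ₐ[ℂ] MvPolynomial (Fin 2) ℂ)) r p' hr.prime
      ((hmem _).mpr hπr)
      ((hmem _).mpr (by
        rw [← hb]
        exact ((hπr.trans (map_dvd _ hrq)).mul_left b))) hrp
    obtain ⟨x, hx⟩ := isMaximal_iff_eq_vanishingIdeal_singleton.mp hmax
    have hm : ∀ i, π ∣ aeval ![f, g] (X i - C (x i)) := fun i => by
      rw [← hmem, hx, mem_vanishingIdeal_singleton_iff]
      simp
    have h0 := hm 0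
    have h1 := hm 1
    simp only [map_sub, aeval_X] at h0 h1
    exact KellerBir.no_contract f g π c hc hjac hπp (x 0) (x 1)
      (by simpa using h0) (by simpa using h1)
end
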